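/- Fix n ≥ 3 and set α = 1 and θ = 1/2. Then the expected power-stake ratio expression specializes to the known uniform-distribution formula: ∫_0^{1/2} P_{X_1}(c)·[Σ_{k=1}^{n−2} (C(n−1,k)/2^{n−1})·(Δ(1/(2(1−c)); k, 1) − Δ((1/2−c)/(1−c); k, 1))]/c dc + ∫_{1/2}^1 P_{X_1}(c)/c dc equals ∫_0^{1/2} [(n−1)(1−c)^{n−2}/(c·2^{n−1})] · Σ_{k=1}^{n−2} C(n−1,k) Σ_{j=k}^{n−2} C(n−2,j) [ ((1/2)/(1−c))^j (1−(1/2)/(1−c))^{n−2−j} − ((1/2−c)/(1−c))^j (1−(1/2−c)/(1−c))^{n−2−j} ] dc + ∫_{1/2}^1 (n−1)(1−c)^{n−2}/c dc, where for α = 1 one has P_{X_1}(c) = (n−1)(1−c)^{n−2}. -/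

import Mathlib

open Finset

/-- The (complete) Beta function `Bt(a,b) = ∫_0^1 t^(a-1) (1-t)^(b-1) dt`. -/
noncomputable def Bt (a b : ℝ) : ℝ := ∫ t in (0 : ℝ)..1, t ^ (a - 1) * (1 - t) ^ (b - 1)

/-- The incomplete Beta function `Bt(h; a, b) = ∫_0^h t^(a-1) (1-t)^(b-1) dt`. -/
noncomputable def BtInc (h a b : ℝ) : ℝ := ∫ t in (0 : ℝ)..h, t ^ (a - 1) * (1 - t) ^ (b - 1)

/-- The regularized incomplete Beta function
`Δ(h; k, α) = Bt(h; kα, (n-1-k)α) / Bt(kα, (n-1-k)α)` (for `n` agents). -/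
noncomputable def Δreg (n : ℕ) (h : ℝ) (k : ℕ) (α : ℝ) : ℝ :=
  BtInc h (k * α) (((n : ℝ) - 1 - k) * α) / Bt (k * α) (((n : ℝ) - 1 - k) * α)

/-- Density of the Beta(α, (n-1)α) distribution:
`P_{X₁}(c) = Γ(nα)/(Γ(α)Γ((n-1)α)) · c^(α-1) (1-c)^((n-1)α-1)`. -/
noncomputable def PX1 (n : ℕ) (α : ℝ) (c : ℝ) : ℝ :=
  Real.Gamma (n * α) / (Real.Gamma α * Real.Gamma ((n - 1) * α)) *
    c ^ (α - 1) * (1 - c) ^ ((n - 1) * α - 1)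

/-- The upper tail of the binomial distribution, as a function of the success probability, has
derivative a multiple of a Beta density. -/
theorem hasDerivAt_binomial_tail (N k : ℕ) (hk : k ≤ N) (x : ℝ) :
    HasDerivAt (fun x : ℝ => ∑ j ∈ Icc k N, (N.choose j : ℝ) * (x ^ j * (1 - x) ^ (N - j)))
      (k * N.choose k * (x ^ (k - 1) * (1 - x) ^ (N - k))) x := by
  set g : ℕ → ℝ := fun j => j * N.choose j * (x ^ (j - 1) * (1 - x) ^ (N - j)) with hg
  have hterm : ∀ j ∈ Icc k N, HasDerivAt
      (fun x : ℝ => (N.choose j : ℝ) * (x ^ j * (1 - x) ^ (N - j))) (g j - g (j + 1)) x := by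
    intro j _
    have hsub : HasDerivAt (fun y : ℝ => 1 - y) (-1) x := by
      simpa using (hasDerivAt_id x).const_sub 1
    refine (((hasDerivAt_pow j x).mul (hsub.pow (N - j))).const_mul _).congr_deriv ?_
    have hchoose : (N.choose (j + 1) : ℝ) * ((j : ℝ) + 1) = N.choose j * ((N - j : ℕ) : ℝ) := by
      exact_mod_cast Nat.choose_succ_right_eq N j
    have hexp : N - (j + 1) = N - j - 1 := by omega
    simp only [hg, hexp, Nat.add_sub_cancel, Nat.cast_add, Nat.cast_one, Pi.pow_apply]
    linear_combination x ^ j * (1 - x) ^ (N - j - 1) * hchoose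
  refine (HasDerivAt.fun_sum hterm).congr_deriv ?_
  have htel : ∑ j ∈ Icc k N, (g j - g (j + 1)) = g k - g (N + 1) := by
    have h := Finset.sum_Ico_sub g (show k ≤ N + 1 by omega)
    rw [← Finset.Ico_add_one_right_eq_Icc, ← neg_sub (g (N + 1)), ← h,
      ← Finset.sum_neg_distrib]
    simp
  rw [htel]
  simp [hg]

/-- The integral of a Beta density with integer parameters is a binomial tail. -/
theorem integral_pow_mul_one_sub_pow (N k : ℕ) (hk1 : 1 ≤ k) (hk : k ≤ N) (h : ℝ) :
    ∫ t in (0 : ℝ)..h, t ^ (k - 1) * (1 - t) ^ (N - k) =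
      (∑ j ∈ Icc k N, (N.choose j : ℝ) * (h ^ j * (1 - h) ^ (N - j))) / (k * N.choose k) := by
  have hne : (k : ℝ) * N.choose k ≠ 0 := by
    have := Nat.choose_pos hk
    positivity
  rw [eq_div_iff hne, mul_comm, ← intervalIntegral.integral_const_mul,
    intervalIntegral.integral_eq_sub_of_hasDerivAt
      (fun x _ => hasDerivAt_binomial_tail N k hk x)
      (Continuous.intervalIntegrable (by fun_prop) _ _)]
  have hzero : ∑ j ∈ Icc k N, (N.choose j : ℝ) * ((0 : ℝ) ^ j * (1 - 0) ^ (N - j)) = 0 := by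
    refine Finset.sum_eq_zero fun j hj => ?_
    have hj0 : j ≠ 0 := by have := (Finset.mem_Icc.mp hj).1; omega
    simp [hj0]
  rw [hzero, sub_zero]

theorem binomial_tail_one (N k : ℕ) (hk : k ≤ N) :
    ∑ j ∈ Icc k N, (N.choose j : ℝ) * ((1 : ℝ) ^ j * (1 - 1) ^ (N - j)) = 1 := by
  rw [Finset.sum_eq_single N]
  · simp
  · intro j hj hjN
    have : N - j ≠ 0 := by have := (Finset.mem_Icc.mp hj).2; omega
    simp [this]
  · simp [hk]

theorem BtInc_natCast (n k : ℕ) (hk1 : 1 ≤ k) (hk : k ≤ n - 2) (h : ℝ) :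
    BtInc h (k * 1) (((n : ℝ) - 1 - k) * 1) =
      (∑ j ∈ Icc k (n - 2), ((n - 2).choose j : ℝ) * (h ^ j * (1 - h) ^ (n - 2 - j))) /
        (k * (n - 2).choose k) := by
  rw [← integral_pow_mul_one_sub_pow (n - 2) k hk1 hk h, BtInc]
  have h1 : (k : ℝ) * 1 - 1 = ((k - 1 : ℕ) : ℝ) := by
    rw [Nat.cast_sub hk1]; simp
  have h2 : ((n : ℝ) - 1 - k) * 1 - 1 = ((n - 2 - k : ℕ) : ℝ) := by
    rw [Nat.cast_sub hk, Nat.cast_sub (by omega)]; push_cast; ring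
  simp only [h1, h2, Real.rpow_natCast]

/-- With integer parameters the regularized incomplete Beta function is a binomial tail. -/
theorem Δreg_one (n k : ℕ) (hk1 : 1 ≤ k) (hk : k ≤ n - 2) (h : ℝ) :
    Δreg n h k 1 =
      ∑ j ∈ Icc k (n - 2), ((n - 2).choose j : ℝ) * (h ^ j * (1 - h) ^ (n - 2 - j)) := by
  have hne : (k : ℝ) * (n - 2).choose k ≠ 0 := by
    have := Nat.choose_pos hk
    positivity
  have hBt : Bt (k * 1) (((n : ℝ) - 1 - k) * 1) = 1 / (k * (n - 2).choose k) := by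
    have h1 := BtInc_natCast n k hk1 hk 1
    rwa [binomial_tail_one (n - 2) k hk] at h1
  rw [Δreg, hBt, BtInc_natCast n k hk1 hk h, div_div_div_cancel_right₀ hne, div_one]

theorem PX1_one (n : ℕ) (hn : 2 ≤ n) (c : ℝ) :
    PX1 n 1 c = ((n : ℝ) - 1) * (1 - c) ^ (n - 2) := by
  obtain ⟨m, rfl⟩ := Nat.exists_eq_add_of_le' hn
  have hm : (m : ℝ) + 1 ≠ 0 := by positivity
  have hGamma : Real.Gamma ((m : ℝ) + 1 + 1) = (m + 1) * Real.Gamma (m + 1) :=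
    Real.Gamma_add_one hm
  have hpos : Real.Gamma ((m : ℝ) + 1) ≠ 0 := (Real.Gamma_pos_of_pos (by positivity)).ne'
  have h1 : ((m + 2 : ℕ) : ℝ) * 1 = m + 1 + 1 := by push_cast; ring
  have h2 : (((m + 2 : ℕ) : ℝ) - 1) * 1 = m + 1 := by push_cast; ring
  rw [PX1, h1, h2, hGamma, Real.Gamma_one, add_sub_cancel_right, sub_self, Real.rpow_zero,
    Real.rpow_natCast, Nat.add_sub_cancel, one_mul, mul_div_cancel_right₀ _ hpos]
  push_cast
  ring

/-- For `n ≥ 3`, `α = 1` and `θ = 1/2`, the expected power-stake ratio expression specializes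
to the uniform-distribution formula of Jelnov and Tauman (for `α = 1` the density `P_{X₁}`
equals `(n-1)(1-c)^(n-2)`). -/
theorem expected_power_stake_ratio_uniform_special_case (n : ℕ) (hn : 3 ≤ n) :
    (∫ c in (0 : ℝ)..(1 / 2), PX1 n 1 c *
        (∑ k ∈ Finset.Icc 1 (n - 2), ((n - 1).choose k : ℝ) / 2 ^ (n - 1) *
          (Δreg n ((1 / 2) / (1 - c)) k 1 - Δreg n ((1 / 2 - c) / (1 - c)) k 1)) / c)
      + (∫ c in (1 / 2 : ℝ)..1, PX1 n 1 c / c)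
    = (∫ c in (0 : ℝ)..(1 / 2), ((n : ℝ) - 1) * (1 - c) ^ (n - 2) / (c * 2 ^ (n - 1)) *
        ∑ k ∈ Finset.Icc 1 (n - 2), ((n - 1).choose k : ℝ) *
          ∑ j ∈ Finset.Icc k (n - 2), ((n - 2).choose j : ℝ) *
            (((1 / 2) / (1 - c)) ^ j * (1 - (1 / 2) / (1 - c)) ^ (n - 2 - j)
              - ((1 / 2 - c) / (1 - c)) ^ j * (1 - (1 / 2 - c) / (1 - c)) ^ (n - 2 - j)))
      + ∫ c in (1 / 2 : ℝ)..1, ((n : ℝ) - 1) * (1 - c) ^ (n - 2) / c := by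
  have hPX : ∀ c, PX1 n 1 c = ((n : ℝ) - 1) * (1 - c) ^ (n - 2) := PX1_one n (by omega)
  simp only [hPX]
  congr 1
  refine intervalIntegral.integral_congr fun c _ => ?_
  have hΔ : ∀ k ∈ Icc 1 (n - 2), ((n - 1).choose k : ℝ) / 2 ^ (n - 1) *
      (Δreg n ((1 / 2) / (1 - c)) k 1 - Δreg n ((1 / 2 - c) / (1 - c)) k 1) =
      (2 ^ (n - 1))⁻¹ * (((n - 1).choose k : ℝ) *
        ∑ j ∈ Icc k (n - 2), ((n - 2).choose j : ℝ) *
          (((1 / 2) / (1 - c)) ^ j * (1 - (1 / 2) / (1 - c)) ^ (n - 2 - j)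
            - ((1 / 2 - c) / (1 - c)) ^ j * (1 - (1 / 2 - c) / (1 - c)) ^ (n - 2 - j))) := by
    intro k hk
    obtain ⟨hk1, hk2⟩ := Finset.mem_Icc.mp hk
    simp only [Δreg_one n k hk1 hk2, mul_sub, Finset.sum_sub_distrib]
    rw [div_eq_inv_mul, mul_assoc, mul_assoc]
  rw [Finset.sum_congr rfl hΔ, ← Finset.mul_sum]
  generalize (∑ k ∈ Icc 1 (n - 2), _ : ℝ) = S
  rw [div_eq_mul_inv _ (c * 2 ^ (n - 1)), mul_inv]
  ring
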